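/- Limit of a strictly increasing chain of integer half-spaces: Let n ≥ 1 and let (H_k)_{k ∈ ℕ} be a sequence of integer half-spaces in ℤⁿ such that H_k ⊊ H_{k+1} for every k. Then ⋃_{k ∈ ℕ} H_k = ℤⁿ. -/

import Mathlib

/-- If a nonempty integer half-space with normal `b` lies in one with normal `a`, then
every vector in the linear half-space of `b` lies in that of `a`. -/
theorem dotProduct_nonneg_of_halfspace_subset {ι : Type*} [Fintype ι] {a b : ι → ℤ} {c d : ℤ}
    (hsub : ∀ x : ι → ℤ, 0 ≤ b ⬝ᵥ x + d → 0 ≤ a ⬝ᵥ x + c)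
    {x₀ : ι → ℤ} (hx₀ : 0 ≤ b ⬝ᵥ x₀ + d) {v : ι → ℤ} (hv : 0 ≤ b ⬝ᵥ v) : 0 ≤ a ⬝ᵥ v := by
  by_contra! hneg
  have hm : 0 ≤ a ⬝ᵥ x₀ + c := hsub x₀ hx₀
  have key := hsub (x₀ + (a ⬝ᵥ x₀ + c + 1) • v) (by
    rw [dotProduct_add, dotProduct_smul, smul_eq_mul]
    nlinarith)
  rw [dotProduct_add, dotProduct_smul, smul_eq_mul] at key
  nlinarith

/-- Limit of a strictly increasing chain of integer half-spaces: if
`H_k = {x ∈ ℤⁿ | a_k·x + c_k ≥ 0}` satisfies `H_k ⊊ H_{k+1}` for every `k`,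
then `⋃_k H_k = ℤⁿ`. -/
theorem increasing_halfspace_chain_union_univ (n : ℕ) (hn : 1 ≤ n)
    (a : ℕ → Fin n → ℤ) (c : ℕ → ℤ)
    (hchain : ∀ k : ℕ,
      {x : Fin n → ℤ | 0 ≤ (∑ i, a k i * x i) + c k} ⊂
      {x : Fin n → ℤ | 0 ≤ (∑ i, a (k + 1) i * x i) + c (k + 1)}) :
    (⋃ k : ℕ, {x : Fin n → ℤ | 0 ≤ (∑ i, a k i * x i) + c k}) = Set.univ := by
  set H : ℕ → Set (Fin n → ℤ) := fun k => {x | 0 ≤ a k ⬝ᵥ x + c k} with hH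
  change ∀ k, H k ⊂ H (k + 1) at hchain
  change ⋃ k, H k = Set.univ
  have hmono : Monotone H := monotone_nat_of_le_succ fun k => (hchain k).subset
  choose x hx hx' using fun k => Set.exists_of_ssubset (hchain k)
  have hup : ∀ k u w, u ∈ H (k + 1) → a 1 ⬝ᵥ u ≤ a 1 ⬝ᵥ w → w ∈ H (k + 1) := by
    intro k u w hu huw
    have hdiff : 0 ≤ a (k + 1) ⬝ᵥ (w - u) :=
      dotProduct_nonneg_of_halfspace_subset (fun z hz => hmono (Nat.le_add_left 1 k) hz) (hx 0)
        (by rw [dotProduct_sub]; linarith)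
    rw [dotProduct_sub] at hdiff
    simp only [hH, Set.mem_ofPred_eq] at hu ⊢
    linarith
  have hdec : ∀ k : ℕ, a 1 ⬝ᵥ x k ≤ a 1 ⬝ᵥ x 0 - k := by
    intro k
    induction k with
    | zero => simp
    | succ k ih =>
      have hlt : a 1 ⬝ᵥ x (k + 1) < a 1 ⬝ᵥ x k := by
        by_contra! hle
        exact hx' (k + 1) (hup k _ _ (hx k) hle)
      push_cast
      linarith
  refine Set.eq_univ_of_forall fun y => Set.mem_iUnion.2 ?_
  let m := (a 1 ⬝ᵥ x 0 - a 1 ⬝ᵥ y).toNat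
  refine ⟨m + 1, hup m (x m) y (hx m) ?_⟩
  have hm := Int.self_le_toNat (a 1 ⬝ᵥ x 0 - a 1 ⬝ᵥ y)
  have := hdec m
  linarith
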